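/- Let k ≥ 3 be an integer and suppose there is a constant c' > 0 such that every weakly-(k−1)-cross-free family on any finite ground set of size m ≥ 1 has at most c'·m members. Then for all positive integers h and α there exists a constant c > 0 (depending only on k, h, α, c') with the following property: if X is a finite set of size n ≥ 1 and F ⊆ 2^X is a weakly-k-cross-free family that is extremal (i.e. |F|/n ≥ |F'|/|X'| for every nonempty finite set X' with |X'| ≤ n and every weakly-k-cross-free family F' ⊆ 2^{X'}) and satisfies |F| ≥ c·n, then F contains a collection {C_i}_{i ∈ I} of pairwise disjoint continuous chains with |I| ≥ α·n and |C_i| = h + 1 for every i ∈ I. -/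

import Mathlib

open Finset

/-- Two subsets `A` and `B` are weakly-crossing if none of the three sets
`A ∩ B`, `A \ B`, `B \ A` is empty. -/
def WeaklyCrossing {α : Type*} [DecidableEq α] (A B : Finset α) : Prop :=
  (A ∩ B).Nonempty ∧ (A \ B).Nonempty ∧ (B \ A).Nonempty

/-- A family is weakly-`k`-cross-free if it contains no `k` members that are
pairwise weakly-crossing. -/
def WeaklyCrossFreeFam {α : Type*} [DecidableEq α] (k : ℕ)
    (F : Finset (Finset α)) : Prop :=
  ¬ ∃ S : Finset (Finset α), S ⊆ F ∧ S.card = k ∧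
      (S : Set (Finset α)).Pairwise WeaklyCrossing

/-- `C` is a continuous chain: its members can be enumerated as
`A_1 ⊆ A_2 ⊆ … ⊆ A_s` with `|A_{i+1}| = |A_i| + 1` for each `i`. -/
def IsContinuousChain {α : Type*} [DecidableEq α] (C : Finset (Finset α)) : Prop :=
  ∃ f : ℕ → Finset α,
    (∀ n < C.card, f n ∈ C) ∧
    (∀ A ∈ C, ∃ n < C.card, f n = A) ∧
    (∀ n, n + 1 < C.card → f n ⊆ f (n + 1) ∧ (f (n + 1)).card = (f n).card + 1)

theorem not_weaklyCrossing_self {α : Type*} [DecidableEq α] (A : Finset α) :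
    ¬ WeaklyCrossing A A := by
  simp [WeaklyCrossing]

theorem WeaklyCrossing.symm {α : Type*} [DecidableEq α] {A B : Finset α}
    (hAB : WeaklyCrossing A B) : WeaklyCrossing B A :=
  ⟨by rw [inter_comm]; exact hAB.1, hAB.2.2, hAB.2.1⟩

theorem WeaklyCrossing.mono_erase {α : Type*} [DecidableEq α] {A B : Finset α} (x : α)
    (hAB : WeaklyCrossing (A.erase x) (B.erase x)) : WeaklyCrossing A B := by
  simp only [WeaklyCrossing, Finset.Nonempty, mem_inter, mem_sdiff, mem_erase] at *
  grind

theorem WeaklyCrossFreeFam.image_erase {α : Type*} [DecidableEq α] {k : ℕ}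
    {F : Finset (Finset α)} (hF : WeaklyCrossFreeFam k F) (x : α) :
    WeaklyCrossFreeFam k (F.image (·.erase x)) := by
  rintro ⟨S, hSF, hSk, hS⟩
  obtain ⟨T, hTF, hinj, rfl⟩ := exists_subset_injOn_image_eq_of_surjOn
    (f := fun A : Finset α => A.erase x) F S fun B hB => by simpa using hSF hB
  refine hF ⟨T, coe_subset.1 hTF, by rw [← hSk, card_image_of_injOn hinj], fun A hA B hB hne => ?_⟩
  exact (hS (mem_coe.2 (mem_image_of_mem _ hA)) (mem_coe.2 (mem_image_of_mem _ hB))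
    (fun h => hne (hinj hA hB h))).mono_erase x

theorem card_lt_of_weaklyCrossFreeFam {α : Type*} [DecidableEq α] {k : ℕ}
    {F G : Finset (Finset α)} (hF : WeaklyCrossFreeFam k F) (hGF : G ⊆ F)
    (hG : k ≤ #G → (G : Set (Finset α)).Pairwise WeaklyCrossing) : #G < k := by
  by_contra! hk
  obtain ⟨S, hS, hSk⟩ := exists_subset_card_eq hk
  exact hF ⟨S, hS.trans hGF, hSk, (hG hk).mono (coe_subset.2 hS)⟩

open Classical in
theorem card_covBy_above_lt {α : Type*} [DecidableEq α] {k : ℕ}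
    {F : Finset (Finset α)} (hF : WeaklyCrossFreeFam k F) {A : Finset α} (hA : A.Nonempty) :
    #{B ∈ F | A ⋖ B} < k := by
  refine card_lt_of_weaklyCrossFreeFam hF (filter_subset _ _) fun _ B hB C hC hne => ?_
  simp only [coe_filter, Set.mem_ofPred_eq, covBy_iff_exists_insert] at hB hC
  obtain ⟨-, x, hx, rfl⟩ := hB
  obtain ⟨-, y, hy, rfl⟩ := hC
  obtain ⟨z, hz⟩ := hA
  have hxy : x ≠ y := fun h => hne (by rw [h])
  exact ⟨⟨z, by simp [hz]⟩, ⟨x, by simp [hx, hxy]⟩, ⟨y, by simp [hy, hxy.symm]⟩⟩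

open Classical in
theorem card_covBy_below_lt {α : Type*} [DecidableEq α] {k : ℕ} (hk : 3 ≤ k)
    {F : Finset (Finset α)} (hF : WeaklyCrossFreeFam k F) (B : Finset α) :
    #{A ∈ F | A ⋖ B} < k := by
  refine card_lt_of_weaklyCrossFreeFam hF (filter_subset _ _) fun hcard A hA C hC hne => ?_
  have hsub : {A ∈ F | A ⋖ B} ⊆ B.image (B.erase ·) := by
    intro A hA
    obtain ⟨x, hx, rfl⟩ := covBy_iff_exists_insert.1 (mem_filter.1 hA).2
    exact mem_image.2 ⟨x, mem_insert_self _ _, erase_insert hx⟩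
  have hB : 3 ≤ #B := hk.trans (hcard.trans ((card_le_card hsub).trans card_image_le))
  obtain ⟨x, hx, rfl⟩ := mem_image.1 (hsub hA)
  obtain ⟨y, hy, rfl⟩ := mem_image.1 (hsub hC)
  have hxy : x ≠ y := fun h => hne (by simp [h])
  obtain ⟨z, hz⟩ : ((B.erase x).erase y).Nonempty := by
    rw [← card_pos, card_erase_of_mem (by simp [hxy.symm, hy]), card_erase_of_mem hx]
    omega
  simp only [mem_erase] at hz
  exact ⟨⟨z, by simp [hz]⟩, ⟨y, by simp [hy, hxy.symm]⟩, ⟨x, by simp [hx, hxy]⟩⟩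

/-- A finite set has a maximal subset whose elements are pairwise unrelated. -/
theorem exists_maximal_unrelated {γ : Type*} (P : Finset γ) (r : γ → γ → Prop)
    (hrefl : ∀ p ∈ P, r p p) (hsymm : ∀ p q, r p q → r q p) :
    ∃ Q ⊆ P, (∀ p ∈ Q, ∀ q ∈ Q, p ≠ q → ¬ r p q) ∧ ∀ p ∈ P, ∃ q ∈ Q, r q p := by
  classical
  induction P using Finset.induction_on with
  | empty => exact ⟨∅, by simp⟩
  | insert p P _ ih =>
    obtain ⟨Q, hQP, hQ, hmax⟩ := ih fun q hq => hrefl q (mem_insert_of_mem hq)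
    by_cases hp : ∃ q ∈ Q, r q p
    · exact ⟨Q, hQP.trans (subset_insert _ _), hQ, by simpa using ⟨hp, hmax⟩⟩
    · have hpp := hrefl p (mem_insert_self _ _)
      refine ⟨insert p Q, insert_subset_insert _ hQP, ?_, ?_⟩
      · simp only [mem_insert]
        grind
      · simp only [mem_insert]
        grind

theorem card_filter_iterate_mem_le {γ : Type*} [DecidableEq γ] {k : ℕ} (F U : Finset γ)
    (f : γ → γ) (hf : ∀ p ∈ F, f p ∈ F) (hfib : ∀ q, #{p ∈ F | f p = q} ≤ k) (i : ℕ) :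
    #{p ∈ F | f^[i] p ∈ U} ≤ k ^ i * #U := by
  induction i with
  | zero =>
    simp only [Function.iterate_zero, id, pow_zero, one_mul]
    exact card_le_card fun p hp => (mem_filter.1 hp).2
  | succ i ih =>
    calc #{p ∈ F | f^[i + 1] p ∈ U} ≤ k * #{p ∈ F | f^[i] p ∈ U} := by
          refine card_le_mul_card_image_of_maps_to (f := f) (fun p hp => ?_) k fun q _ => ?_
          · obtain ⟨hpF, hpU⟩ := mem_filter.1 hp
            exact mem_filter.2 ⟨hf p hpF, hpU⟩
          · exact (card_le_card (filter_subset_filter _ (filter_subset _ _))).trans (hfib q)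
      _ ≤ k * (k ^ i * #U) := Nat.mul_le_mul_left _ ih
      _ = k ^ (i + 1) * #U := by ring

theorem card_le_of_iterate_mem {γ : Type*} [DecidableEq γ] {k h : ℕ} (hk : 1 ≤ k)
    (F U : Finset γ) (f : γ → γ) (hf : ∀ p ∈ F, f p ∈ F)
    (hfib : ∀ q, #{p ∈ F | f p = q} ≤ k) (hU : ∀ p ∈ F, ∃ i ≤ h, f^[i] p ∈ U) :
    #F ≤ (h + 1) * k ^ h * #U := by
  have hsub : F ⊆ (range (h + 1)).biUnion fun i => {p ∈ F | f^[i] p ∈ U} := by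
    intro p hp
    obtain ⟨i, hi, hiU⟩ := hU p hp
    exact mem_biUnion.2 ⟨i, mem_range.2 (by omega), mem_filter.2 ⟨hp, hiU⟩⟩
  calc #F ≤ #(range (h + 1)) * (k ^ h * #U) := by
        refine (card_le_card hsub).trans (card_biUnion_le_card_mul _ _ _ fun i hi => ?_)
        refine (card_filter_iterate_mem_le F U f hf hfib i).trans (Nat.mul_le_mul_right _ ?_)
        exact Nat.pow_le_pow_right hk (by rw [mem_range] at hi; omega)
    _ = (h + 1) * k ^ h * #U := by rw [card_range]; ring

open Classical in
/-- If a cross-free family contains no two members covered by a common member, then its members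
covered at least twice form a family that is cross-free for a smaller parameter. -/
theorem weaklyCrossFreeFam_pred {α : Type*} [DecidableEq α] {k : ℕ} (hk : 3 ≤ k)
    {F Q : Finset (Finset α)} (hF : WeaklyCrossFreeFam k F) (hQF : Q ⊆ F)
    (htwo : ∀ A ∈ Q, 1 < #{B ∈ F | A ⋖ B})
    (hsep : ∀ A ∈ Q, ∀ A' ∈ Q, A ≠ A' → ¬ ∃ B ∈ F, A ⋖ B ∧ A' ⋖ B) :
    WeaklyCrossFreeFam (k - 1) Q := by
  rintro ⟨S, hSQ, hSk, hS⟩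
  obtain ⟨A, hAS, hmin⟩ := exists_min_image S card (card_pos.1 (by omega))
  obtain ⟨B, hB, C, hC, hBC⟩ := one_lt_card.1 (htwo A (hSQ hAS))
  rw [mem_filter] at hB hC
  have hcross : ∀ D ∈ S.erase A, ∀ B ∈ F, A ⋖ B → WeaklyCrossing B D := by
    intro D hD B hBF hAB
    obtain ⟨hDA, hDS⟩ := mem_erase.1 hD
    obtain ⟨h1, h2, h3⟩ := hS hAS hDS hDA.symm
    refine ⟨h1.mono (inter_subset_inter_right hAB.le),
      h2.mono (sdiff_subset_sdiff hAB.le le_rfl), ?_⟩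
    rw [sdiff_nonempty]
    intro hDB
    refine hsep A (hSQ hAS) D (hSQ hDS) hDA.symm ⟨B, hBF, hAB, ?_⟩
    obtain ⟨x, hx, rfl⟩ := covBy_iff_exists_insert.1 hAB
    have hcard := hmin D hDS
    have hne : D ≠ insert x A := by
      rintro rfl
      exact h2.ne_empty (sdiff_eq_empty_iff_subset.2 (subset_insert _ _))
    have hlt := card_lt_card (hDB.ssubset_of_ne hne)
    rw [card_insert_of_notMem hx] at hlt
    rw [covBy_iff_card_sdiff_eq_one]
    refine ⟨hDB, ?_⟩
    rw [card_sdiff_of_subset hDB, card_insert_of_notMem hx]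
    omega
  obtain ⟨D, hD⟩ : (S.erase A).Nonempty := by
    rw [← card_pos, card_erase_of_mem hAS]; omega
  have hA : A.Nonempty :=
    (hS hAS (mem_of_mem_erase hD) (ne_of_mem_erase hD).symm).1.mono inter_subset_left
  have hBC' : WeaklyCrossing B C := by
    obtain ⟨x, hx, rfl⟩ := covBy_iff_exists_insert.1 hB.2
    obtain ⟨y, hy, rfl⟩ := covBy_iff_exists_insert.1 hC.2
    obtain ⟨z, hz⟩ := hA
    have hxy : x ≠ y := fun h => hBC (by rw [h])
    exact ⟨⟨z, by simp [hz]⟩, ⟨x, by simp [hx, hxy]⟩, ⟨y, by simp [hy, hxy.symm]⟩⟩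
  have hCS : C ∉ S.erase A := fun h => not_weaklyCrossing_self C (hcross C h C hC.1 hC.2)
  have hBS : B ∉ insert C (S.erase A) := by
    rw [mem_insert, not_or]
    exact ⟨hBC, fun h => not_weaklyCrossing_self B (hcross B h B hB.1 hB.2)⟩
  refine hF ⟨insert B (insert C (S.erase A)), ?_, ?_, ?_⟩
  · simp only [insert_subset_iff]
    exact ⟨hB.1, hC.1, (erase_subset _ _).trans (hSQ.trans hQF)⟩
  · rw [card_insert_of_notMem hBS, card_insert_of_notMem hCS, card_erase_of_mem hAS]
    omega
  · rw [coe_insert, coe_insert]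
    refine ((hS.mono (coe_subset.2 (erase_subset A S))).insert fun D hD _ => ?_).insert
      fun D hD _ => ?_
    · exact ⟨hcross D hD C hC.1 hC.2, (hcross D hD C hC.1 hC.2).symm⟩
    · rcases hD with rfl | hD
      · exact ⟨hBC', hBC'.symm⟩
      · exact ⟨hcross D hD B hB.1 hB.2, (hcross D hD B hB.1 hB.2).symm⟩

open Classical in
theorem card_branching_le {α : Type*} [DecidableEq α] {k : ℕ} (hk : 3 ≤ k)
    {F : Finset (Finset α)} (hF : WeaklyCrossFreeFam k F) :
    ∃ Q ⊆ F, WeaklyCrossFreeFam (k - 1) Q ∧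
      #{A ∈ F | A.Nonempty ∧ 1 < #{B ∈ F | A ⋖ B}} ≤ k * k * #Q := by
  set P : Finset (Finset α) := {A ∈ F | A.Nonempty ∧ 1 < #{B ∈ F | A ⋖ B}}
  obtain ⟨Q, hQP, hQ, hmax⟩ := exists_maximal_unrelated P
    (fun A A' => ∃ B ∈ F, A ⋖ B ∧ A' ⋖ B)
    (fun A hA => by
      obtain ⟨B, hB⟩ := card_pos.1 (zero_lt_one.trans (mem_filter.1 hA).2.2)
      rw [mem_filter] at hB
      exact ⟨B, hB.1, hB.2, hB.2⟩)
    (fun A A' ⟨B, hB, h1, h2⟩ => ⟨B, hB, h2, h1⟩)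
  refine ⟨Q, hQP.trans (filter_subset _ _), weaklyCrossFreeFam_pred hk hF
    (hQP.trans (filter_subset _ _)) (fun A hA => (mem_filter.1 (hQP hA)).2.2) hQ, ?_⟩
  have hsub : P ⊆ Q.biUnion fun A => ({B ∈ F | A ⋖ B}).biUnion fun B => {C ∈ F | C ⋖ B} := by
    intro C hC
    obtain ⟨A, hA, B, hB, hAB, hCB⟩ := hmax C hC
    simp only [mem_biUnion, mem_filter]
    exact ⟨A, hA, B, ⟨hB, hAB⟩, (mem_filter.1 hC).1, hCB⟩
  refine (card_le_card hsub).trans ((card_biUnion_le_card_mul _ _ (k * k) fun A hA => ?_).trans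
    (Nat.mul_comm _ _).le)
  refine (card_biUnion_le_card_mul _ _ k fun B _ => (card_covBy_below_lt hk hF B).le).trans ?_
  exact Nat.mul_le_mul_right _ (card_covBy_above_lt hF (mem_filter.1 (hQP hA)).2.1).le

open Classical in
theorem card_eq_card_image_erase_add {α : Type*} [DecidableEq α] (F : Finset (Finset α)) (x : α) :
    #F = #(F.image (·.erase x)) + #{A ∈ F | x ∉ A ∧ insert x A ∈ F} := by
  have hsplit := card_filter_add_card_filter_not (s := F) fun A => x ∉ A ∧ insert x A ∈ F
  have himg : F.image (·.erase x) =
      ({A ∈ F | ¬ (x ∉ A ∧ insert x A ∈ F)}).image (·.erase x) := by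
    refine Subset.antisymm (fun B hB => ?_) (image_subset_image (filter_subset _ _))
    obtain ⟨A, hA, rfl⟩ := mem_image.1 hB
    by_cases hx : x ∉ A ∧ insert x A ∈ F
    · refine mem_image.2 ⟨insert x A, mem_filter.2 ⟨hx.2, by simp⟩, ?_⟩
      rw [erase_insert hx.1, erase_eq_of_notMem hx.1]
    · exact mem_image.2 ⟨A, mem_filter.2 ⟨hA, hx⟩, rfl⟩
  rw [himg, card_image_of_injOn]
  · omega
  · intro A hA B hB hAB
    simp only [coe_filter, Set.mem_ofPred_eq, not_and] at hA hB
    simp only at hAB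
    by_cases hxA : x ∈ A <;> by_cases hxB : x ∈ B
    · rw [← insert_erase hxA, hAB, insert_erase hxB]
    · rw [erase_eq_of_notMem hxB] at hAB
      exact absurd (hB.2 hxB (by rw [← hAB, insert_erase hxA]; exact hA.1)) id
    · rw [erase_eq_of_notMem hxA] at hAB
      exact absurd (hA.2 hxA (by rw [hAB, insert_erase hxB]; exact hB.1)) id
    · rwa [erase_eq_of_notMem hxA, erase_eq_of_notMem hxB] at hAB

open Classical in
theorem sum_card_insert_mem_le {α : Type*} [DecidableEq α] (X : Finset α)
    (F : Finset (Finset α)) :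
    ∑ x ∈ X, #{A ∈ F | x ∉ A ∧ insert x A ∈ F} ≤ ∑ A ∈ F, #{B ∈ F | A ⋖ B} := by
  calc ∑ x ∈ X, #{A ∈ F | x ∉ A ∧ insert x A ∈ F}
      = ∑ A ∈ F, #{x ∈ X | x ∉ A ∧ insert x A ∈ F} :=
        sum_card_bipartiteAbove_eq_sum_card_bipartiteBelow _
    _ ≤ ∑ A ∈ F, #{B ∈ F | A ⋖ B} := by
        refine sum_le_sum fun A _ => card_le_card_of_injOn (insert · A) ?_ ?_
        · intro x hx
          simp only [coe_filter, Set.mem_ofPred_eq] at hx ⊢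
          exact ⟨hx.2.2, covBy_iff_exists_insert.2 ⟨x, hx.2.1, rfl⟩⟩
        · intro x hx y hy hxy
          simp only [coe_filter, Set.mem_ofPred_eq] at hx hy
          exact (insert_inj hx.2.1).1 hxy

open Classical in
theorem card_covBy_above_le {α : Type*} [DecidableEq α] {X : Finset α}
    {F : Finset (Finset α)} (hX : ∀ A ∈ F, A ⊆ X) (A : Finset α) :
    #{B ∈ F | A ⋖ B} ≤ #X := by
  refine (card_le_card (t := X.image (insert · A)) fun B hB => ?_).trans card_image_le
  obtain ⟨hBF, hAB⟩ := mem_filter.1 hB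
  obtain ⟨x, hx, rfl⟩ := covBy_iff_exists_insert.1 hAB
  exact mem_image.2 ⟨x, hX _ hBF (mem_insert_self _ _), rfl⟩

open Classical in
theorem card_maximal_le {α : Type*} [DecidableEq α] {k : ℕ} {X : Finset α}
    {F : Finset (Finset α)} (hX : ∀ A ∈ F, A ⊆ X) (hF : WeaklyCrossFreeFam k F)
    (hsum : #F ≤ ∑ A ∈ F, #{B ∈ F | A ⋖ B}) :
    #{A ∈ F | ∀ B ∈ F, ¬ A ⋖ B} ≤
      k * #{A ∈ F | A.Nonempty ∧ 1 < #{B ∈ F | A ⋖ B}} + #X := by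
  have hpt : ∀ A ∈ F, #{B ∈ F | A ⋖ B} + (if ∀ B ∈ F, ¬ A ⋖ B then 1 else 0) ≤
      1 + (k * (if A.Nonempty ∧ 1 < #{B ∈ F | A ⋖ B} then 1 else 0) +
        if A = ∅ then #X else 0) := by
    intro A _
    by_cases hmax : ∀ B ∈ F, ¬ A ⋖ B
    · rw [if_pos hmax, card_eq_zero.2 (filter_eq_empty_iff.2 fun B hB => hmax B hB)]
      omega
    · rw [if_neg hmax]
      rcases A.eq_empty_or_nonempty with rfl | hA
      · have := card_covBy_above_le hX (∅ : Finset α)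
        simp only [if_true]
        omega
      · have := card_covBy_above_lt hF hA
        by_cases hone : 1 < #{B ∈ F | A ⋖ B}
        · rw [if_pos ⟨hA, hone⟩]; omega
        · omega
  have hempty : (∑ A ∈ F, if A = ∅ then #X else 0) ≤ #X := by
    rw [sum_ite_eq']
    split_ifs <;> simp
  have h := sum_le_sum hpt
  simp only [sum_add_distrib, ← mul_sum, ← card_filter, sum_const, smul_eq_mul, mul_one] at h
  omega

open Classical in
/-- A family in which few members are maximal for the covering relation contains many disjoint
continuous chains. -/
theorem exists_disjoint_continuous_chains {α : Type*} [DecidableEq α] {k : ℕ} (hk : 3 ≤ k)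
    {F : Finset (Finset α)} (hF : WeaklyCrossFreeFam k F) (h : ℕ) :
    ∃ 𝒞 : Finset (Finset (Finset α)),
      (∀ C ∈ 𝒞, C ⊆ F ∧ C.card = h + 1 ∧ IsContinuousChain C) ∧
      (∀ C ∈ 𝒞, ∀ D ∈ 𝒞, C ≠ D → Disjoint C D) ∧
      #F ≤ (h + 1) * k ^ h * (#{A ∈ F | ∀ B ∈ F, ¬ A ⋖ B} + #𝒞 * (h + 1)) := by
  set Z : Finset (Finset α) := {A ∈ F | ∀ B ∈ F, ¬ A ⋖ B}
  have hstep : ∀ A : Finset α, ∃ B, (A ∈ F → B ∈ F) ∧ (B = A ∨ A ⋖ B) ∧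
      (A ∈ F → A ∉ Z → A ⋖ B) := by
    intro A
    by_cases hA : ∃ B ∈ F, A ⋖ B
    · obtain ⟨B, hB, hAB⟩ := hA
      exact ⟨B, fun _ => hB, Or.inr hAB, fun _ _ => hAB⟩
    · refine ⟨A, id, Or.inl rfl, fun hAF hAZ => absurd (mem_filter.2 ⟨hAF, ?_⟩) hAZ⟩
      exact fun B hB hAB => hA ⟨B, hB, hAB⟩
  choose f hfF hfcov hfZ using hstep
  have hit : ∀ i, ∀ A ∈ F, f^[i] A ∈ F := by
    intro i
    induction i with
    | zero => exact fun A hA => hA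
    | succ i ih => exact fun A hA => ih _ (hfF A hA)
  have hfib : ∀ B, #{A ∈ F | f A = B} ≤ k := by
    intro B
    refine (card_le_card (t := insert B {A ∈ F | A ⋖ B}) fun A hA => ?_).trans
      ((card_insert_le _ _).trans (card_covBy_below_lt hk hF B))
    obtain ⟨hAF, rfl⟩ := mem_filter.1 hA
    rcases hfcov A with hfA | hfA
    · rw [hfA]; exact mem_insert_self _ _
    · exact mem_insert_of_mem (mem_filter.2 ⟨hAF, hfA⟩)
  let chain : Finset α → Finset (Finset α) := fun A => (range (h + 1)).image fun i => f^[i] A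
  obtain ⟨Q, hQ, hdisj, hmax⟩ := exists_maximal_unrelated {A ∈ F | ∀ i ≤ h, f^[i] A ∉ Z}
    (fun A A' => ¬ Disjoint (chain A) (chain A'))
    (fun A _ => by
      rw [disjoint_self_iff_empty]
      exact (nonempty_range_add_one.image _).ne_empty)
    (fun A A' hAA' h => hAA' h.symm)
  have hchain : ∀ C ∈ Q.image chain, C ⊆ F ∧ C.card = h + 1 ∧ IsContinuousChain C := by
    intro C hC
    obtain ⟨A, hA, rfl⟩ := mem_image.1 hC
    obtain ⟨hAF, hAZ⟩ := mem_filter.1 (hQ hA)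
    have hcov : ∀ i ≤ h, f^[i] A ⋖ f^[i + 1] A := by
      intro i hi
      rw [Function.iterate_succ_apply']
      exact hfZ _ (hit i A hAF) (hAZ i hi)
    have hsucc : ∀ i ≤ h, #(f^[i + 1] A) = #(f^[i] A) + 1 := by
      intro i hi
      obtain ⟨x, hx, hxe⟩ := covBy_iff_exists_insert.1 (hcov i hi)
      rw [← hxe, card_insert_of_notMem hx]
    have hcardi : ∀ i ≤ h, #(f^[i] A) = #A + i := by
      intro i
      induction i with
      | zero => simp
      | succ i ih =>
        intro hi
        rw [hsucc i (by omega), ih (by omega), add_assoc]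
    have hcard : #(chain A) = h + 1 := by
      rw [card_image_of_injOn, card_range]
      intro i hi j hj hij
      simp only [coe_range, Set.mem_Iio] at hi hj
      have hi' := hcardi i (by omega)
      have hj' := hcardi j (by omega)
      simp only at hij
      rw [hij] at hi'
      omega
    refine ⟨fun B hB => ?_, hcard, fun i => f^[i] A, ?_, ?_, ?_⟩
    · obtain ⟨i, -, rfl⟩ := mem_image.1 hB
      exact hit i A hAF
    · rw [hcard]
      exact fun i hi => mem_image_of_mem _ (mem_range.2 hi)
    · rw [hcard]
      intro B hB
      obtain ⟨i, hi, rfl⟩ := mem_image.1 hB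
      exact ⟨i, mem_range.1 hi, rfl⟩
    · rw [hcard]
      exact fun i hi => ⟨(hcov i (by omega)).le, hsucc i (by omega)⟩
  refine ⟨Q.image chain, hchain, ?_, ?_⟩
  · intro C hC D hD hCD
    obtain ⟨A, hA, rfl⟩ := mem_image.1 hC
    obtain ⟨A', hA', rfl⟩ := mem_image.1 hD
    exact not_not.1 (hdisj A hA A' hA' fun h => hCD (by rw [h]))
  · refine (card_le_of_iterate_mem (by omega) F (Z ∪ (Q.image chain).biUnion id) f hfF hfib
      fun A hA => ?_).trans (Nat.mul_le_mul_left _ ((card_union_le _ _).trans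
        (Nat.add_le_add_left (card_biUnion_le_card_mul _ _ _ fun C hC => (hchain C hC).2.1.le) _)))
    by_cases hAZ : ∀ i ≤ h, f^[i] A ∉ Z
    · obtain ⟨B, hB, hBA⟩ := hmax A (mem_filter.2 ⟨hA, hAZ⟩)
      obtain ⟨C, hCB, hCA⟩ := not_disjoint_iff.1 hBA
      obtain ⟨i, hi, rfl⟩ := mem_image.1 hCA
      rw [mem_range] at hi
      exact ⟨i, by omega, mem_union_right _
        (mem_biUnion.2 ⟨chain B, mem_image_of_mem _ hB, hCB⟩)⟩
    · push Not at hAZ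
      obtain ⟨i, hi, hiZ⟩ := hAZ
      exact ⟨i, hi, mem_union_left _ hiZ⟩

open Classical in
theorem card_le_sum_card_covBy_above {α : Type} [DecidableEq α] {k : ℕ} {X : Finset α}
    {F : Finset (Finset α)} (hn : 2 ≤ #X) (hX : ∀ A ∈ F, A ⊆ X) (hF : WeaklyCrossFreeFam k F)
    (hext : ∀ (X' : Finset α) (F' : Finset (Finset α)),
      X'.Nonempty → #X' ≤ #X → (∀ A ∈ F', A ⊆ X') → WeaklyCrossFreeFam k F' →
      (#F' : ℝ) / #X' ≤ (#F : ℝ) / #X) :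
    #F ≤ ∑ A ∈ F, #{B ∈ F | A ⋖ B} := by
  refine le_trans ?_ (sum_card_insert_mem_le X F)
  have hpos : (0 : ℝ) < #X := by exact_mod_cast (by omega : 0 < #X)
  have hx : ∀ x ∈ X, (#F : ℝ) / #X ≤ #{A ∈ F | x ∉ A ∧ insert x A ∈ F} := by
    intro x hx
    have hcard := card_erase_of_mem hx
    have hle := hext (X.erase x) (F.image (·.erase x)) (card_pos.1 (by omega)) (by omega)
      (fun B hB => by
        obtain ⟨A, hA, rfl⟩ := mem_image.1 hB
        exact erase_subset_erase _ (hX A hA)) (hF.image_erase x)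
    have hsplit : (#F : ℝ) = #(F.image (·.erase x)) + #{A ∈ F | x ∉ A ∧ insert x A ∈ F} := by
      exact_mod_cast card_eq_card_image_erase_add F x
    have hcast : (#(X.erase x) : ℝ) = #X - 1 := by
      rw [hcard, Nat.cast_sub (by omega), Nat.cast_one]
    have hpos' : (0 : ℝ) < #X - 1 := by
      have : (2 : ℝ) ≤ #X := by exact_mod_cast hn
      linarith
    rw [hcast, div_le_iff₀ hpos'] at hle
    have hdiv : (#F : ℝ) / #X * (#X - 1) = #F - (#F : ℝ) / #X := by field_simp
    linarith
  have hsum := sum_le_sum hx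
  rw [sum_const, nsmul_eq_mul, mul_div_cancel₀ _ hpos.ne'] at hsum
  exact_mod_cast hsum

/-- An extremal weakly-`k`-cross-free family of size at least `c·n` contains at least
`a·n` pairwise disjoint continuous chains, each of size `h + 1`. -/
theorem chain_extraction (k : ℕ) (hk : 3 ≤ k) (c' : ℝ) (hc' : 0 < c')
    (hbound : ∀ (β : Type) [DecidableEq β] (Y : Finset β) (G : Finset (Finset β)),
      1 ≤ Y.card → (∀ A ∈ G, A ⊆ Y) → WeaklyCrossFreeFam (k - 1) G →
      (G.card : ℝ) ≤ c' * Y.card)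
    (h a : ℕ) (hh : 1 ≤ h) (ha : 1 ≤ a) :
    ∃ c : ℝ, 0 < c ∧
      ∀ (α : Type) [DecidableEq α] (X : Finset α) (F : Finset (Finset α)),
        1 ≤ X.card → (∀ A ∈ F, A ⊆ X) → WeaklyCrossFreeFam k F →
        (∀ (β : Type) [DecidableEq β] (X' : Finset β) (F' : Finset (Finset β)),
          X'.Nonempty → X'.card ≤ X.card → (∀ A ∈ F', A ⊆ X') →
          WeaklyCrossFreeFam k F' →
          (F'.card : ℝ) / X'.card ≤ (F.card : ℝ) / X.card) →
        c * X.card ≤ F.card →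
        ∃ 𝒞 : Finset (Finset (Finset α)),
          (∀ C ∈ 𝒞, C ⊆ F ∧ C.card = h + 1 ∧ IsContinuousChain C) ∧
          (∀ C ∈ 𝒞, ∀ D ∈ 𝒞, C ≠ D → Disjoint C D) ∧
          a * X.card ≤ 𝒞.card := by
  classical
  refine ⟨(h + 1) * k ^ h * (k * (k * k * c') + 2 + a * (h + 1)), by positivity, ?_⟩
  intro α _ X F hn hX hF hext hFn
  obtain ⟨𝒞, hchain, hdisj, hle⟩ := exists_disjoint_continuous_chains hk hF h
  refine ⟨𝒞, hchain, hdisj, ?_⟩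
  obtain ⟨Q, hQF, hQ, hPQ⟩ := card_branching_le hk hF
  have hQn := hbound α X Q hn (fun A hA => hX A (hQF hA)) hQ
  have hXpos : (1 : ℝ) ≤ #X := by exact_mod_cast hn
  have hZ : (#{A ∈ F | ∀ B ∈ F, ¬ A ⋖ B} : ℝ) ≤ (k * (k * k * c') + 2) * #X := by
    rcases hn.eq_or_lt with hone | htwo
    · have hF2 : #F ≤ 2 := by
        refine (card_le_card (t := X.powerset) fun A hA => mem_powerset.2 (hX A hA)).trans ?_
        rw [card_powerset, ← hone, pow_one]
      have : (#{A ∈ F | ∀ B ∈ F, ¬ A ⋖ B} : ℝ) ≤ 2 := by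
        exact_mod_cast (card_filter_le _ _).trans hF2
      have : 0 ≤ k * (k * k * c') := by positivity
      nlinarith
    · have hmax := card_maximal_le hX hF (card_le_sum_card_covBy_above htwo hX hF
        fun X' F' => hext α X' F')
      have hPQ' : (#{A ∈ F | A.Nonempty ∧ 1 < #{B ∈ F | A ⋖ B}} : ℝ) ≤ k * k * #Q := by
        exact_mod_cast hPQ
      calc (#{A ∈ F | ∀ B ∈ F, ¬ A ⋖ B} : ℝ)
          ≤ k * #{A ∈ F | A.Nonempty ∧ 1 < #{B ∈ F | A ⋖ B}} + #X := by exact_mod_cast hmax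
        _ ≤ k * (k * k * (c' * #X)) + #X := by
            gcongr
            exact hPQ'.trans (by gcongr)
        _ ≤ (k * (k * k * c') + 2) * #X := by linarith
  have hle' : (#F : ℝ) ≤ (h + 1) * k ^ h *
      (#{A ∈ F | ∀ B ∈ F, ¬ A ⋖ B} + #𝒞 * (h + 1)) := by
    exact_mod_cast hle
  have hmul := hFn.trans hle'
  rw [mul_assoc] at hmul
  have hmul' := le_of_mul_le_mul_left hmul (by positivity)
  have hfin : (a * #X : ℝ) * (h + 1) ≤ #𝒞 * (h + 1) := by linarith
  exact_mod_cast le_of_mul_le_mul_right hfin (by positivity)
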